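/- arXiv:2306.03165 — 2 statements merged into one kernel-verified Lean document; each statement's English description precedes it below -/
import Mathlib

section
/- Fix a compact Riemannian manifold (Σ,σ) and 0 < h₀ < 1. On M = [0,2] × Σ, let f_j : [0,2] → (0,1] be continuous with f_j = h₀ on [0, 1/(j+1)], f_j = 1 on [1/j, 2], and f_j increasing from h₀ to 1 on [1/(j+1), 1/j], and set g_j = −dt² + f_j²σ and g = −dt² + σ. Then the null distances d̂_{t,g_j} converge uniformly to the metric d₀ given by d₀(p,q) = min{ d̂_{t,g}(p,q), t(p) + t(q) + h₀ · d_σ( (J^−_g(p) ∩ Σ₀)_Σ, (J^−_g(q) ∩ Σ₀)_Σ ) }, where Σ_t = {t} × Σ; in particular d₀ ≠ d̂_{t,g}, so d̂_{t,g_j} does not converge to d̂_{t,g}. -/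
open Set MeasureTheory Filter Topology

namespace NullDistPaper

variable {S : Type*} [PseudoMetricSpace S]

/-- A future-directed causal piece of a curve in the warped product spacetime
`([t₀,t₁] × S, -dt² + f(t,x)² σ)`, parametrized by the time coordinate on `[a,b]`:
the spatial part `x` is continuous, and its σ-length (total variation) over any
subinterval is at most the corresponding integral of `1/f` along the curve. -/
def FutureCausalPiece (f : ℝ → S → ℝ) (x : ℝ → S) (a b : ℝ) : Prop :=
  a ≤ b ∧ ContinuousOn x (Set.Icc a b) ∧
    ∀ c ∈ Set.Icc a b, ∀ d ∈ Set.Icc a b, c ≤ d →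
      eVariationOn x (Set.Icc c d) ≤ ENNReal.ofReal (∫ t in c..d, 1 / f t (x t))

/-- `q` lies in the causal future of `p`, i.e. there is a future-directed causal
curve from `p` to `q`. -/
def FutureRelated (f : ℝ → S → ℝ) (p q : ℝ × S) : Prop :=
  p.1 ≤ q.1 ∧ ∃ x : ℝ → S, x p.1 = p.2 ∧ x q.1 = q.2 ∧ FutureCausalPiece f x p.1 q.1

/-- `q ∈ J^±(p)` : `q` is causally related to `p`. -/
def CausallyRelated (f : ℝ → S → ℝ) (p q : ℝ × S) : Prop :=
  FutureRelated f p q ∨ FutureRelated f q p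

/-- A piecewise causal curve in `[t₀,t₁] × S` from `p` to `q`, recorded by its
breakpoints; consecutive breakpoints are joined by a future- or past-directed
causal piece. -/
structure PiecewiseCausal (f : ℝ → S → ℝ) (t₀ t₁ : ℝ) (p q : ℝ × S) where
  k : ℕ
  hk : 0 < k
  pt : ℕ → ℝ × S
  h0 : pt 0 = p
  hlast : pt k = q
  hstrip : ∀ i ≤ k, (pt i).1 ∈ Set.Icc t₀ t₁
  piece : ∀ i < k, CausallyRelated f (pt i) (pt (i + 1))

/-- The null length of a piecewise causal curve with respect to the
time function `τ`. -/
noncomputable def nullLength (τ : ℝ × S → ℝ) {f : ℝ → S → ℝ} {t₀ t₁ : ℝ} {p q : ℝ × S}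
    (γ : PiecewiseCausal f t₀ t₁ p q) : ℝ :=
  ∑ i ∈ Finset.range γ.k, |τ (γ.pt (i + 1)) - τ (γ.pt i)|

/-- The null distance on `[t₀,t₁] × S` for the warped product `-dt² + f(t,x)²σ`
and the time function `τ`. -/
noncomputable def nullDist (f : ℝ → S → ℝ) (τ : ℝ × S → ℝ) (t₀ t₁ : ℝ) (p q : ℝ × S) : ℝ :=
  sInf {L : ℝ | ∃ γ : PiecewiseCausal f t₀ t₁ p q, L = nullLength τ γ}

/-- Warping function depending only on the time coordinate. -/
def tWarp (f : ℝ → ℝ) : ℝ → S → ℝ := fun t _ => f t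

/-- The metric of `S` is intrinsic (a length metric): any two points can be
joined by continuous curves of length arbitrarily close to their distance.
This encodes that `(S, d)` comes from a (continuous) Riemannian metric. -/
def IsLengthSpace (S : Type*) [PseudoMetricSpace S] : Prop :=
  ∀ x y : S, ∀ ε > 0, ∃ γ : ℝ → S, γ 0 = x ∧ γ 1 = y ∧ ContinuousOn γ (Set.Icc 0 1) ∧
    eVariationOn γ (Set.Icc 0 1) ≤ ENNReal.ofReal (dist x y + ε)

end NullDistPaper

open NullDistPaper Set Filter

namespace NullDistPaper

/-- Distance between two subsets of a metric space,
`d(A,B) = inf { d(a,b) : a ∈ A, b ∈ B }`. -/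
noncomputable def setDist {S : Type*} [PseudoMetricSpace S] (A B : Set S) : ℝ :=
  sInf {r : ℝ | ∃ a ∈ A, ∃ b ∈ B, r = dist a b}

end NullDistPaper

namespace NullDistPaper

lemma nd_lim {S : Type*} [PseudoMetricSpace S] {γ : ℝ → S} (hγ : ContinuousOn γ (Icc 0 1))
    {a b K : ℝ} (ha : 0 ≤ a) (hab : a < b) (hb : b ≤ 1)
    (h : ∀ u v, a < u → u < v → v < b → dist (γ u) (γ v) ≤ K) : dist (γ a) (γ b) ≤ K := by
  apply le_of_forall_pos_le_add
  intro ε hε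
  have h1 : ∀ᶠ u in 𝓝[Ioo a ((a+b)/2)] a, dist (γ u) (γ a) < ε / 2 := by
    have := (hγ a ⟨ha, by linarith⟩).mono (s := Ioo a ((a+b)/2))
      (fun u hu => ⟨by linarith [hu.1], by linarith [hu.2]⟩)
    exact (Metric.tendsto_nhds.1 this) _ (by linarith)
  have h2 : ∀ᶠ u in 𝓝[Ioo ((a+b)/2) b] b, dist (γ u) (γ b) < ε / 2 := by
    have := (hγ b ⟨by linarith, hb⟩).mono (s := Ioo ((a+b)/2) b)
      (fun u hu => ⟨by linarith [hu.1], by linarith [hu.2]⟩)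
    exact (Metric.tendsto_nhds.1 this) _ (by linarith)
  have : (𝓝[Ioo a ((a+b)/2)] a).NeBot := left_nhdsWithin_Ioo_neBot (by linarith)
  have : (𝓝[Ioo ((a+b)/2) b] b).NeBot := right_nhdsWithin_Ioo_neBot (by linarith)
  obtain ⟨u, hu, hu'⟩ := (h1.and self_mem_nhdsWithin).exists
  obtain ⟨v, hv, hv'⟩ := (h2.and self_mem_nhdsWithin).exists
  have h3 := h u v hu'.1 (by linarith [hu'.2, hv'.1]) hv'.2
  have h4 := dist_triangle4 (γ a) (γ u) (γ v) (γ b)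
  rw [dist_comm (γ a) (γ u)] at h4
  linarith

lemma nd_lip {S : Type*} [PseudoMetricSpace S] {γ : ℝ → S} (hγ : ContinuousOn γ (Icc 0 1))
    (V : ℝ → ℝ) (D : ℝ) (hD : 0 < D) (hV0 : V 0 = 0) (hV1 : V 1 ≤ D)
    (hV : ∀ u v, 0 ≤ u → u ≤ v → v ≤ 1 → dist (γ u) (γ v) ≤ V v - V u) :
    ∃ g : ℝ → S, dist (γ 0) (g 0) ≤ 0 ∧ g 1 = γ 1 ∧
      ∀ s t, 0 ≤ s → s ≤ t → t ≤ 1 → dist (g s) (g t) ≤ D * (t - s) := by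
  have hmono : ∀ u v, 0 ≤ u → u ≤ v → v ≤ 1 → V u ≤ V v := fun u v h1 h2 h3 => by
    linarith [hV u v h1 h2 h3, dist_nonneg (x := γ u) (y := γ v)]
  let A : ℝ → Set ℝ := fun s => {u | u ∈ Icc (0:ℝ) 1 ∧ V u ≤ D * s}
  let τ : ℝ → ℝ := fun s => sSup (A s)
  have hbdd : ∀ s, BddAbove (A s) := fun s => ⟨1, fun u hu => hu.1.2⟩
  have h0A : ∀ s, 0 ≤ s → (0:ℝ) ∈ A s := fun s hs => ⟨⟨le_rfl, zero_le_one⟩, by rw [hV0]; positivity⟩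
  have hτ0 : ∀ s, 0 ≤ s → 0 ≤ τ s := fun s hs => le_csSup (hbdd s) (h0A s hs)
  have hτ1 : ∀ s, 0 ≤ s → τ s ≤ 1 := fun s hs => csSup_le ⟨0, h0A s hs⟩ (fun u hu => hu.1.2)
  have hlow : ∀ s, 0 ≤ s → ∀ v, 0 ≤ v → v < τ s → V v ≤ D * s := by
    intro s hs v hv hvs
    obtain ⟨w, hw, hvw⟩ := exists_lt_of_lt_csSup ⟨0, h0A s hs⟩ hvs
    exact (hmono v w hv hvw.le hw.1.2).trans hw.2
  have hup : ∀ s, 0 ≤ s → ∀ u, τ s < u → u ≤ 1 → D * s ≤ V u := by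
    intro s hs u hu hu1
    by_contra hc
    push Not at hc
    have : u ∈ A s := ⟨⟨by linarith [hτ0 s hs], hu1⟩, hc.le⟩
    linarith [le_csSup (hbdd s) this]
  refine ⟨fun s => γ (τ s), ?_, ?_, ?_⟩
  · rcases (hτ0 0 le_rfl).eq_or_lt with h | h
    · simp only [← h, dist_self, le_refl]
    · refine nd_lim hγ le_rfl h (hτ1 0 le_rfl) (fun u v hu huv hv => ?_)
      have h1 := hlow 0 le_rfl v (by linarith) hv
      have h2 := hV u v hu.le huv.le (by linarith [hτ1 0 le_rfl])
      have h3 := hmono 0 u le_rfl hu.le (by linarith [hτ1 0 le_rfl])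
      linarith
  · have : (1:ℝ) ∈ A 1 := ⟨⟨zero_le_one, le_rfl⟩, by linarith⟩
    have : τ 1 = 1 := le_antisymm (hτ1 1 zero_le_one) (le_csSup (hbdd 1) this)
    simp only [this]
  · intro s t hs hst ht
    have ht0 := hs.trans hst
    have hle : τ s ≤ τ t := csSup_le_csSup (hbdd t) ⟨0, h0A s hs⟩
      (fun u hu => ⟨hu.1, hu.2.trans (by gcongr)⟩)
    rcases hle.eq_or_lt with h | h
    · simp only [h, dist_self]
      exact mul_nonneg hD.le (by linarith)
    · refine nd_lim hγ (hτ0 s hs) h (hτ1 t ht0) (fun u v hu huv hv => ?_)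
      have h0 := hτ0 s hs
      have h1' := hτ1 t ht0
      have h1 := hlow t ht0 v (by linarith) hv
      have h2 := hV u v (by linarith) huv.le (by linarith)
      have h3 := hup s hs u hu (by linarith)
      linarith

lemma nd_geod {S : Type*} [MetricSpace S] (hLS : IsLengthSpace S) (x y : S) (D : ℝ)
    (hD : dist x y < D) :
    ∃ g : ℝ → S, g 0 = x ∧ g 1 = y ∧
      ∀ s t, 0 ≤ s → s ≤ t → t ≤ 1 → dist (g s) (g t) ≤ D * (t - s) := by
  obtain ⟨γ, h0, h1, hc, hv⟩ := hLS x y (D - dist x y) (by linarith)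
  have hD0 : 0 < D := dist_nonneg.trans_lt hD
  rw [add_sub_cancel] at hv
  have hfin : ∀ a b, 0 ≤ a → b ≤ 1 → eVariationOn γ (Icc a b) ≠ ⊤ := fun a b ha hb =>
    ne_top_of_le_ne_top (ne_top_of_le_ne_top ENNReal.ofReal_ne_top hv)
      (eVariationOn.mono γ (Icc_subset_Icc ha hb))
  obtain ⟨g, hg0, hg1, hg⟩ := nd_lip hc (fun u => (eVariationOn γ (Icc 0 u)).toReal) D hD0
    (by simp [eVariationOn.subsingleton])
    (ENNReal.toReal_le_of_le_ofReal hD0.le hv) (by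
      intro u v hu huv hv1
      have h := eVariationOn.Icc_add_Icc γ (s := univ) hu huv (mem_univ _)
      simp only [univ_inter] at h
      simp only [← h]
      rw [ENNReal.toReal_add (hfin _ _ le_rfl (huv.trans hv1)) (hfin _ _ hu hv1), add_sub_cancel_left,
        dist_edist]
      exact ENNReal.toReal_mono (hfin _ _ hu hv1)
        (eVariationOn.edist_le γ ⟨le_rfl, huv⟩ ⟨huv, le_rfl⟩))
  refine ⟨g, ?_, hg1.trans h1, hg⟩
  rw [← h0]; exact (dist_le_zero.1 hg0).symm

/-- hypotheses on the warping function -/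
def NdOK (f : ℝ → ℝ) : Prop := ContinuousOn f (Icc 0 2) ∧ ∀ t ∈ Icc (0:ℝ) 2, 0 < f t

lemma NdOK.int {f : ℝ → ℝ} (hf : NdOK f) {a b : ℝ} (ha : 0 ≤ a) (hab : a ≤ b) (hb : b ≤ 2) :
    IntervalIntegrable (fun t => 1 / f t) volume a b := by
  apply ContinuousOn.intervalIntegrable
  rw [uIcc_of_le hab]
  have hs : Icc a b ⊆ Icc 0 2 := Icc_subset_Icc ha hb
  exact continuousOn_const.div (hf.1.mono hs) (fun t ht => (hf.2 t (hs ht)).ne')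

lemma NdOK.int_ge {f : ℝ → ℝ} (hf : NdOK f) {a b c : ℝ} (ha : 0 ≤ a) (hab : a ≤ b) (hb : b ≤ 2)
    (hc : ∀ t ∈ Icc a b, f t ≤ c) : (b - a) / c ≤ ∫ t in a..b, 1 / f t := by
  have := intervalIntegral.integral_mono_on hab (f := fun _ => 1 / c) (g := fun t => 1 / f t)
    (by simp) (hf.int ha hab hb) (fun t ht =>
      one_div_le_one_div_of_le (hf.2 t ⟨ha.trans ht.1, ht.2.trans hb⟩) (hc t ht))
  rw [intervalIntegral.integral_const, smul_eq_mul] at this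
  rw [div_eq_mul_one_div]; exact this

lemma NdOK.int_le {f : ℝ → ℝ} (hf : NdOK f) {a b c : ℝ} (ha : 0 ≤ a) (hab : a ≤ b) (hb : b ≤ 2)
    (hc0 : 0 < c) (hc : ∀ t ∈ Icc a b, c ≤ f t) : ∫ t in a..b, 1 / f t ≤ (b - a) / c := by
  have := intervalIntegral.integral_mono_on hab (g := fun _ => 1 / c) (f := fun t => 1 / f t)
    (hf.int ha hab hb) (by simp) (fun t ht => one_div_le_one_div_of_le hc0 (hc t ht))
  rw [intervalIntegral.integral_const, smul_eq_mul] at this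
  rw [div_eq_mul_one_div]; exact this

lemma nd_one : NdOK (fun _ => (1:ℝ)) := ⟨continuousOn_const, fun _ _ => one_pos⟩

lemma nd_future_dist {S : Type*} [MetricSpace S] {f : ℝ → ℝ} {p q : ℝ × S} (hf : NdOK f)
    (hp : 0 ≤ p.1) (hq : q.1 ≤ 2)
    (h : FutureRelated (tWarp f) p q) : dist p.2 q.2 ≤ ∫ t in p.1..q.1, 1 / f t := by
  obtain ⟨hle, x, hx, hy, _, _, hv⟩ := h
  have h1 := hv p.1 ⟨le_rfl, hle⟩ q.1 ⟨hle, le_rfl⟩ hle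
  have h2 := (eVariationOn.edist_le x (s := Icc p.1 q.1) ⟨le_rfl, hle⟩ ⟨hle, le_rfl⟩).trans h1
  rw [hx, hy, edist_dist] at h2
  refine (ENNReal.ofReal_le_ofReal_iff ?_).1 h2
  exact intervalIntegral.integral_nonneg hle (fun t ht =>
    one_div_nonneg.2 (hf.2 t ⟨hp.trans ht.1, ht.2.trans hq⟩).le)

lemma nd_transfer {S : Type*} [MetricSpace S] {f : ℝ → ℝ} {p q : ℝ × S} (hf : NdOK f)
    (hf1 : ∀ t ∈ Icc (0:ℝ) 2, f t ≤ 1) (hp : 0 ≤ p.1) (hq : q.1 ≤ 2)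
    (h : FutureRelated (tWarp fun _ => (1:ℝ)) p q) : FutureRelated (tWarp f) p q := by
  obtain ⟨hle, x, hx, hy, h1, h2, hv⟩ := h
  refine ⟨hle, x, hx, hy, h1, h2, fun c hc d hd hcd => (hv c hc d hd hcd).trans ?_⟩
  apply ENNReal.ofReal_le_ofReal
  have h0 := hf.int_ge (c := 1) (hp.trans hc.1) hcd (hd.2.trans hq)
    (fun t ht => hf1 t ⟨(hp.trans hc.1).trans ht.1, ht.2.trans (hd.2.trans hq)⟩)
  simp only [tWarp, div_one, intervalIntegral.integral_const, smul_eq_mul, mul_one] at h0 ⊢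
  exact h0

lemma nd_mk {S : Type*} [MetricSpace S] {f : ℝ → ℝ} (hf : NdOK f) {g : ℝ → S} {D : ℝ}
    (hD : 0 < D)
    (hg : ∀ s t, 0 ≤ s → s ≤ t → t ≤ 1 → dist (g s) (g t) ≤ D * (t - s))
    {a b c s₀ s₁ : ℝ} (ha : 0 ≤ a) (hab : a ≤ b) (hb : b ≤ 2) (hc : 0 < c)
    (hfc : ∀ t ∈ Icc a b, f t ≤ c) (hs₀ : s₀ ∈ Icc (0:ℝ) 1) (hs₁ : s₁ ∈ Icc (0:ℝ) 1)
    (h : c * (D * |s₁ - s₀|) ≤ b - a) :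
    FutureRelated (tWarp f) (a, g s₀) (b, g s₁) := by
  have hg' : ∀ s ∈ Icc (0:ℝ) 1, ∀ t ∈ Icc (0:ℝ) 1, dist (g s) (g t) ≤ D * |t - s| := by
    intro s hs t ht
    rcases le_total s t with h | h
    · rw [abs_of_nonneg (by linarith)]; exact hg s t hs.1 h ht.2
    · rw [abs_of_nonpos (by linarith), dist_comm]
      have := hg t s ht.1 h hs.2
      linarith
  rcases hab.eq_or_lt with rfl | hlt
  · have h0 : |s₁ - s₀| = 0 := by
      by_contra hne
      have : 0 < |s₁ - s₀| := lt_of_le_of_ne (abs_nonneg _) (Ne.symm hne)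
      have : 0 < c * (D * |s₁ - s₀|) := by positivity
      linarith
    have : s₁ = s₀ := by linarith [abs_eq_zero.1 h0]
    subst this
    refine ⟨le_rfl, fun _ => g s₁, rfl, rfl, le_rfl, continuousOn_const, fun c hc d hd hcd => ?_⟩
    rw [eVariationOn.subsingleton]
    · exact zero_le
    · intro u hu v hv
      have := hc.1; have := hd.2
      simp only [mem_Icc] at *
      linarith
  have hba : 0 < b - a := by linarith
  let ψ : ℝ → ℝ := fun t => s₀ + (t - a) / (b - a) * (s₁ - s₀)
  have hψ : ∀ t ∈ Icc a b, ψ t ∈ Icc (0:ℝ) 1 := by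
    intro t ht
    have h1 : 0 ≤ (t - a) / (b - a) := div_nonneg (by linarith [ht.1]) hba.le
    have h2 : (t - a) / (b - a) ≤ 1 := (div_le_one hba).2 (by linarith [ht.2])
    obtain ⟨h3, h4⟩ := hs₀
    obtain ⟨h5, h6⟩ := hs₁
    simp only [ψ]
    constructor <;> nlinarith
  have hL : LipschitzOnWith (Real.toNNReal (1/c)) (fun t => g (ψ t)) (Icc a b) := by
    apply LipschitzOnWith.of_dist_le_mul
    intro u hu v hv
    rw [Real.coe_toNNReal _ (by positivity), Real.dist_eq]
    refine (hg' _ (hψ u hu) _ (hψ v hv)).trans ?_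
    have : ψ v - ψ u = (v - u) / (b - a) * (s₁ - s₀) := by simp only [ψ]; ring
    rw [this, abs_mul, abs_div, abs_of_pos hba, abs_sub_comm v u]
    have h1 : D * |s₁ - s₀| / (b - a) ≤ 1 / c := by
      rw [div_le_div_iff₀ hba hc]; linarith
    calc _ = D * |s₁ - s₀| / (b - a) * |u - v| := by ring
      _ ≤ _ := by gcongr
  refine ⟨hab, fun t => g (ψ t), ?_, ?_, hab, hL.continuousOn, ?_⟩
  · simp [ψ]
  · simp [ψ, div_self hba.ne']
  · intro u hu v hv huv
    have hsub : Icc u v ⊆ Icc a b := Icc_subset_Icc hu.1 hv.2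
    have h1 := hL.comp_eVariationOn_le (g := id) (s := Icc u v) (fun t ht => hsub ht)
    rw [eVariationOn_id_Icc] at h1
    refine (le_trans h1 ?_)
    rw [← ENNReal.ofReal, ← ENNReal.ofReal_mul (by positivity)]
    apply ENNReal.ofReal_le_ofReal
    have h2 := hf.int_ge (c := c) (ha.trans hu.1) huv (hv.2.trans hb) (fun t ht => hfc t (hsub ht))
    rw [div_eq_mul_one_div, mul_comm] at h2
    exact h2

lemma nd_int_split {f : ℝ → ℝ} (hf : NdOK f) {h δ a b : ℝ} (hh : 0 < h)
    (hfh : ∀ t ∈ Icc (0:ℝ) 2, h ≤ f t) (hf1 : ∀ t ∈ Icc δ 2, 1 ≤ f t)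
    (ha : 0 ≤ a) (hab : a ≤ b) (hb : b ≤ 2) :
    ∫ t in a..b, 1 / f t ≤ (max b δ - max a δ) + (min b δ - min a δ) / h := by
  rcases le_total b δ with hbδ | hbδ
  · have := hf.int_le ha hab hb hh (fun t ht => hfh t ⟨ha.trans ht.1, ht.2.trans hb⟩)
    rw [max_eq_right hbδ, max_eq_right (hab.trans hbδ), min_eq_left hbδ, min_eq_left (hab.trans hbδ)]
    linarith
  rcases le_total δ a with haδ | haδ
  · have := hf.int_le ha hab hb one_pos (fun t ht => hf1 t ⟨haδ.trans ht.1, ht.2.trans hb⟩)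
    rw [max_eq_left hbδ, max_eq_left haδ, min_eq_right hbδ, min_eq_right haδ]
    simp only [div_one, sub_self, zero_div, add_zero] at this ⊢
    exact this
  · have h1 := hf.int_le ha haδ (hbδ.trans hb) hh
      (fun t ht => hfh t ⟨ha.trans ht.1, ht.2.trans (hbδ.trans hb)⟩)
    have h2 := hf.int_le (ha.trans haδ) hbδ hb one_pos
      (fun t ht => hf1 t ⟨ht.1, ht.2.trans hb⟩)
    have h3 := intervalIntegral.integral_add_adjacent_intervals
      (hf.int ha haδ (hbδ.trans hb)) (hf.int (ha.trans haδ) hbδ hb)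
    rw [max_eq_left hbδ, max_eq_right haδ, min_eq_right hbδ, min_eq_left haδ]
    rw [div_one] at h2
    linarith

lemma nd_piece {S : Type*} [MetricSpace S] {f : ℝ → ℝ} (hf : NdOK f) {h δ : ℝ} (hh : 0 < h)
    (hfh : ∀ t ∈ Icc (0:ℝ) 2, h ≤ f t) (hf1 : ∀ t ∈ Icc δ 2, 1 ≤ f t)
    {p q : ℝ × S} (hp : p.1 ∈ Icc (0:ℝ) 2) (hq : q.1 ∈ Icc (0:ℝ) 2)
    (hc : CausallyRelated (tWarp f) p q) :
    dist p.2 q.2 ≤ |max q.1 δ - max p.1 δ| + |min q.1 δ - min p.1 δ| / h := by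
  have key : ∀ p q : ℝ × S, p.1 ∈ Icc (0:ℝ) 2 → q.1 ∈ Icc (0:ℝ) 2 → FutureRelated (tWarp f) p q →
      dist p.2 q.2 ≤ |max q.1 δ - max p.1 δ| + |min q.1 δ - min p.1 δ| / h := by
    intro p q hp hq hc
    refine (nd_future_dist hf hp.1 hq.2 hc).trans
      ((nd_int_split hf hh hfh hf1 hp.1 hc.1 hq.2).trans ?_)
    gcongr
    · exact le_abs_self _
    · exact le_abs_self _
  rcases hc with hc | hc
  · exact key p q hp hq hc
  · rw [dist_comm, abs_sub_comm, abs_sub_comm (min _ _)]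
    exact key q p hq hp hc

lemma nd_minmax (a b δ : ℝ) : |b - a| = |max b δ - max a δ| + |min b δ - min a δ| := by
  rcases le_total a b with h | h
  · rw [abs_of_nonneg (by linarith), abs_of_nonneg (sub_nonneg.2 (max_le_max_right _ h)),
      abs_of_nonneg (sub_nonneg.2 (min_le_min_right _ h))]
    linarith [max_add_min a δ, max_add_min b δ]
  · rw [abs_of_nonpos (by linarith), abs_of_nonpos (sub_nonpos.2 (max_le_max_right _ h)),
      abs_of_nonpos (sub_nonpos.2 (min_le_min_right _ h))]
    linarith [max_add_min a δ, max_add_min b δ]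

lemma nd_lower {S : Type*} [MetricSpace S] {f : ℝ → ℝ} (hf : NdOK f) {h δ : ℝ} (hh : 0 < h)
    (hfh : ∀ t ∈ Icc (0:ℝ) 2, h ≤ f t) (hf1 : ∀ t ∈ Icc δ 2, 1 ≤ f t)
    {p q : ℝ × S} (γ : PiecewiseCausal (tWarp f) 0 2 p q) :
    |q.1 - p.1| ≤ nullLength (fun p => p.1) γ ∧
    ∃ M N : ℝ, 0 ≤ M ∧ 0 ≤ N ∧ nullLength (fun p => p.1) γ = M + N ∧ dist p.2 q.2 ≤ M + N / h ∧
      (N = 0 ∨ p.1 + q.1 - 2 * δ ≤ M) := by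
  have ht := dist_le_range_sum_dist (fun i => (γ.pt i).1) γ.k
  have hd := dist_le_range_sum_dist (fun i => (γ.pt i).2) γ.k
  simp only [γ.h0, γ.hlast] at ht hd
  refine ⟨?_, ∑ i ∈ Finset.range γ.k, |max (γ.pt (i+1)).1 δ - max (γ.pt i).1 δ|,
    ∑ i ∈ Finset.range γ.k, |min (γ.pt (i+1)).1 δ - min (γ.pt i).1 δ|,
    Finset.sum_nonneg (fun _ _ => abs_nonneg _), Finset.sum_nonneg (fun _ _ => abs_nonneg _), ?_, ?_, ?_⟩
  · rw [abs_sub_comm, ← Real.dist_eq]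
    refine ht.trans (le_of_eq (Finset.sum_congr rfl (fun i _ => ?_)))
    rw [dist_comm, Real.dist_eq]
  · rw [← Finset.sum_add_distrib]
    exact Finset.sum_congr rfl (fun i _ => nd_minmax _ _ _)
  · rw [Finset.sum_div, ← Finset.sum_add_distrib]
    refine hd.trans (Finset.sum_le_sum (fun i hi => ?_))
    rw [Finset.mem_range] at hi
    exact nd_piece hf hh hfh hf1 (γ.hstrip i hi.le) (γ.hstrip (i+1) hi) (γ.piece i hi)
  · by_cases hcase : ∃ i ≤ γ.k, (γ.pt i).1 ≤ δ
    · right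
      obtain ⟨i, hi, hiδ⟩ := hcase
      have h1 := dist_le_Ico_sum_dist (fun i => max (γ.pt i).1 δ) (Nat.zero_le i)
      have h2 := dist_le_Ico_sum_dist (fun i => max (γ.pt i).1 δ) hi
      have h3 := Finset.sum_Ico_consecutive (fun i => dist (max (γ.pt i).1 δ) (max (γ.pt (i+1)).1 δ))
        (Nat.zero_le i) hi
      have h4 : ∑ i ∈ Finset.range γ.k, |max (γ.pt (i+1)).1 δ - max (γ.pt i).1 δ| =
        ∑ i ∈ Finset.range γ.k, dist (max (γ.pt i).1 δ) (max (γ.pt (i+1)).1 δ) :=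
        Finset.sum_congr rfl (fun i _ => by rw [dist_comm, Real.dist_eq])
      simp only [γ.h0, γ.hlast, max_eq_right hiδ] at h1 h2
      rw [h4]
      simp only [Real.dist_eq] at *
      have h5 := le_abs_self (max p.1 δ - δ)
      have h6 := neg_abs_le (δ - max q.1 δ)
      have h7 := le_max_left p.1 δ
      have h8 := le_max_left q.1 δ
      simp only [← Finset.range_eq_Ico] at h1 h3
      linarith
    · left
      push Not at hcase
      apply Finset.sum_eq_zero
      intro i hi
      rw [Finset.mem_range] at hi
      rw [min_eq_right (hcase i hi.le).le, min_eq_right (hcase (i+1) hi).le]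
      simp

/-- reachability with given null length -/
inductive NdReach {S : Type*} [PseudoMetricSpace S] (f : ℝ → S → ℝ) :
    (ℝ × S) → (ℝ × S) → ℝ → Prop
  | base (p : ℝ × S) (hp : p.1 ∈ Icc (0:ℝ) 2) : NdReach f p p 0
  | step (p q r : ℝ × S) (L : ℝ) (h : NdReach f p q L) (hq : q.1 ∈ Icc (0:ℝ) 2)
      (hr : r.1 ∈ Icc (0:ℝ) 2) (hc : CausallyRelated f q r) : NdReach f p r (L + |r.1 - q.1|)

section
variable {S : Type*} [MetricSpace S] {f : ℝ → S → ℝ} {p q r : ℝ × S} {L L' : ℝ}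

lemma NdReach.single (hp : p.1 ∈ Icc (0:ℝ) 2) (hq : q.1 ∈ Icc (0:ℝ) 2)
    (h : CausallyRelated f p q) : NdReach f p q |q.1 - p.1| := by
  have := NdReach.step p p q 0 (.base p hp) hp hq h
  rwa [zero_add] at this

lemma NdReach.tr (h : NdReach f p q L) (h' : NdReach f q r L') : NdReach f p r (L + L') := by
  induction h' with
  | base => rwa [add_zero]
  | step q r L' h' hq hr hc ih =>
    rw [← add_assoc]
    exact .step _ _ _ _ ih hq hr hc

lemma NdReach.sym (h : NdReach f p q L) : NdReach f q p L := by
  induction h with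
  | base hp => exact .base p hp
  | step q r L h hq hr hc ih =>
    rw [add_comm, abs_sub_comm]
    exact (NdReach.single hr hq hc.symm).tr ih

lemma nd_refl (p : ℝ × S) : CausallyRelated f p p := by
  left
  refine ⟨le_rfl, fun _ => p.2, rfl, rfl, le_rfl, continuousOn_const, fun c hc d hd _ => ?_⟩
  rw [eVariationOn.subsingleton]
  · exact zero_le
  · intro u hu v hv
    have := hc.1; have := hd.2
    simp only [mem_Icc] at *
    linarith

lemma NdReach.curve (h : NdReach f p q L) :
    ∃ γ : PiecewiseCausal f 0 2 p q, L = nullLength (fun p => p.1) γ := by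
  induction h with
  | base hp =>
    exact ⟨⟨1, one_pos, fun _ => p, rfl, rfl, fun _ _ => hp, fun _ _ => nd_refl p⟩,
      by simp [nullLength]⟩
  | step q r L h hq hr hc ih =>
    obtain ⟨γ, hγ⟩ := ih
    refine ⟨⟨γ.k + 1, Nat.succ_pos _, fun i => if i ≤ γ.k then γ.pt i else r, ?_, ?_, ?_, ?_⟩, ?_⟩
    · simp [γ.h0]
    · simp
    · intro i _
      split_ifs with h
      · exact γ.hstrip i h
      · exact hr
    · intro i hi
      rw [if_pos (Nat.lt_succ_iff.1 hi)]
      split_ifs with h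
      · exact γ.piece i h
      · have : i = γ.k := by omega
        rw [this, γ.hlast]; exact hc
    · simp only [nullLength] at hγ ⊢
      rw [Finset.sum_range_succ, hγ]
      congr 1
      · refine Finset.sum_congr rfl (fun i hi => ?_)
        rw [Finset.mem_range] at hi
        rw [if_pos (show i + 1 ≤ γ.k from hi), if_pos hi.le]
      · simp [γ.hlast]

lemma nd_bdd : BddBelow {L : ℝ | ∃ γ : PiecewiseCausal f 0 2 p q, L = nullLength (fun p => p.1) γ} := by
  refine ⟨0, ?_⟩
  rintro L ⟨γ, rfl⟩
  exact Finset.sum_nonneg (fun _ _ => abs_nonneg _)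

lemma NdReach.le (h : NdReach f p q L) : nullDist f (fun p => p.1) 0 2 p q ≤ L :=
  csInf_le nd_bdd h.curve

end

/-- zigzag -/
lemma nd_zig {S : Type*} [MetricSpace S] {f : ℝ → ℝ} (hf : NdOK f) {g : ℝ → S} {D : ℝ}
    (hD : 0 < D)
    (hg : ∀ s t, 0 ≤ s → s ≤ t → t ≤ 1 → dist (g s) (g t) ≤ D * (t - s))
    {a b c : ℝ} (ha : 0 ≤ a) (hab : a < b) (hb : b ≤ 2) (hc : 0 < c)
    (hfc : ∀ t ∈ Icc a b, f t ≤ c) {l : ℝ} (hl : l ∈ Icc (0:ℝ) 1) :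
    NdReach (tWarp f) (a, g l) (a, g 1) (c * (D * (1 - l))) := by
  obtain ⟨n, hn⟩ := exists_nat_gt (c * (D * (1 - l)) / (b - a))
  have hl0 : 0 ≤ 1 - l := by linarith [hl.2]
  have hn0 : (0:ℝ) < n := lt_of_le_of_lt (div_nonneg (by positivity) (by linarith)) hn
  rw [div_lt_iff₀ (by linarith)] at hn
  set η : ℝ := (1 - l) / (2 * n) with hη
  have hη0 : 0 ≤ η := by positivity
  have hηn : 2 * n * η = 1 - l := by rw [hη]; field_simp
  set u : ℝ := c * (D * η) with hu
  have hu0 : 0 ≤ u := by positivity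
  have hub : u ≤ b - a := by
    have : n * (2 * u) ≤ n * (b - a) := by
      rw [hu]
      calc n * (2 * (c * (D * η))) = c * (D * (2 * n * η)) := by ring
        _ ≤ _ := by rw [hηn]; exact hn.le
    have := le_of_mul_le_mul_left this hn0
    linarith
  have key : ∀ m : ℕ, m ≤ n → NdReach (tWarp f) (a, g l) (a, g (l + 2 * m * η)) (2 * m * u) := by
    intro m
    induction m with
    | zero => intro _; simpa using NdReach.base (f := tWarp f) (a, g l) ⟨ha, by linarith⟩
    | succ m ih =>
      intro hm
      have ih := ih (by omega)
      have hm' : (m:ℝ) + 1 ≤ n := by exact_mod_cast hm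
      have hm0 : (0:ℝ) ≤ m := Nat.cast_nonneg m
      have hle : 2 * ((m:ℝ) + 1) * η ≤ 1 - l := by rw [← hηn]; gcongr
      have hx0 : 0 ≤ 2 * (m:ℝ) * η := by positivity
      have hfc' : ∀ t ∈ Icc a (a+u), f t ≤ c := fun t ht => hfc t ⟨ht.1, by linarith [ht.2]⟩
      have e0 : l + 2 * m * η ∈ Icc (0:ℝ) 1 := ⟨by linarith [hl.1], by linarith⟩
      have e1 : l + 2 * m * η + η ∈ Icc (0:ℝ) 1 := ⟨by linarith [hl.1], by linarith⟩
      have e2 : l + 2 * (m + 1) * η ∈ Icc (0:ℝ) 1 := ⟨by linarith [hl.1], by linarith⟩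
      have s1 := nd_mk hf hD hg ha (by linarith : a ≤ a + u) (by linarith) hc hfc' e0 e1
        (by rw [add_sub_cancel_left, abs_of_nonneg hη0]; linarith)
      have s2 := nd_mk hf hD hg ha (by linarith : a ≤ a + u) (by linarith) hc hfc' e2 e1
        (by rw [show l + 2 * m * η + η - (l + 2 * (m + 1) * η) = -η by ring, abs_neg,
              abs_of_nonneg hη0]; linarith)
      have i1 : a ∈ Icc (0:ℝ) 2 := ⟨ha, by linarith⟩
      have i2 : a + u ∈ Icc (0:ℝ) 2 := ⟨by linarith, by linarith⟩
      have r := ih.tr ((NdReach.single i1 i2 (Or.inl s1)).tr (NdReach.single i2 i1 (Or.inr s2)))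
      simp only [add_sub_cancel_left, sub_add_cancel_left, abs_neg, abs_of_nonneg hu0] at r
      push_cast
      convert r using 1
      ring
  have := key n le_rfl
  rw [hηn, add_sub_cancel] at this
  convert this using 1
  rw [hu, ← hηn]; ring

/-- the null distance of the product metric from above -/
lemma nd_one_le {S : Type*} [MetricSpace S] (hLS : IsLengthSpace S) (p q : ℝ × S)
    (hp : p.1 ∈ Icc (0:ℝ) 2) (hq : q.1 ∈ Icc (0:ℝ) 2) {K : ℝ} (h1 : |q.1 - p.1| < K)
    (h2 : dist p.2 q.2 < K) : ∃ L ≤ K, NdReach (tWarp fun _ => (1:ℝ)) p q L := by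
  wlog hpq : p.1 ≤ q.1 generalizing p q
  · obtain ⟨L, hL, h⟩ := this q p hq hp (by rwa [abs_sub_comm]) (by rwa [dist_comm]) (le_of_not_ge hpq)
    exact ⟨L, hL, h.sym⟩
  rw [abs_of_nonneg (by linarith)] at h1
  obtain ⟨D, hD, hDK⟩ := exists_between (max_lt h1 h2)
  obtain ⟨hD1, hD2⟩ := max_lt_iff.1 hD
  have hD0 : 0 < D := by linarith
  obtain ⟨g, g0, g1, hg⟩ := nd_geod hLS p.2 q.2 D hD2
  set l := (q.1 - p.1) / D with hl
  have hl1 : l ∈ Icc (0:ℝ) 1 := ⟨div_nonneg (by linarith) hD0.le, (div_le_one hD0).2 hD1.le⟩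
  have hDl : D * l = q.1 - p.1 := by rw [hl]; field_simp
  have s1 := nd_mk nd_one hD0 hg hp.1 hpq hq.2 one_pos (fun _ _ => le_rfl) ⟨le_rfl, zero_le_one⟩ hl1
    (by rw [sub_zero, abs_of_nonneg hl1.1, hDl]; linarith)
  set η := min 1 ((K - D) / 2) with hη
  have hη0 : 0 < η := lt_min one_pos (by linarith)
  have hη1 : η ≤ 1 := min_le_left _ _
  have hηK : η ≤ (K - D) / 2 := min_le_right _ _
  set a := q.1 * (1 - η / 2) with ha
  obtain ⟨q0, q2⟩ := hq
  have ha0 : 0 ≤ a := mul_nonneg q0 (by linarith)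
  have ha2 : a < 2 := by nlinarith
  have haq : a ≤ q.1 := by nlinarith
  have haη : q.1 - a ≤ η := by nlinarith
  have s2 := nd_zig nd_one hD0 hg ha0 ha2 le_rfl one_pos (fun _ _ => le_rfl) hl1
  have s3 := nd_mk nd_one hD0 hg ha0 haq q2 one_pos (fun _ _ => le_rfl) hl1 hl1
    (by rw [sub_self, abs_zero]; linarith)
  have hone : (1:ℝ) ∈ Icc (0:ℝ) 1 := ⟨zero_le_one, le_rfl⟩
  have s4 := nd_mk nd_one hD0 hg ha0 haq q2 one_pos (fun _ _ => le_rfl) hone hone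
    (by rw [sub_self, abs_zero]; linarith)
  have ia : a ∈ Icc (0:ℝ) 2 := ⟨ha0, ha2.le⟩
  rw [g0] at s1
  rw [g1] at s2 s4
  have r := (NdReach.single (q := (q.1, g l)) hp ⟨q0, q2⟩ (Or.inl s1)).tr ((NdReach.single (p := (q.1, g l)) (q := (a, g l)) ⟨q0, q2⟩ ia (Or.inr s3)).tr
    (s2.tr (NdReach.single ia ⟨q0, q2⟩ (Or.inl s4))))
  refine ⟨_, ?_, r⟩
  dsimp only
  rw [abs_of_nonneg (by linarith : 0 ≤ q.1 - p.1), abs_of_nonpos (by linarith : a - q.1 ≤ 0),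
    abs_of_nonneg (by linarith : 0 ≤ q.1 - a)]
  nlinarith

lemma nd_one_le' {S : Type*} [MetricSpace S] (hLS : IsLengthSpace S) (p q : ℝ × S)
    (hp : p.1 ∈ Icc (0:ℝ) 2) (hq : q.1 ∈ Icc (0:ℝ) 2) {K : ℝ} (h1 : |q.1 - p.1| ≤ K)
    (h2 : dist p.2 q.2 ≤ K) : nullDist (tWarp fun _ => (1:ℝ)) (fun p => p.1) 0 2 p q ≤ K := by
  apply le_of_forall_pos_le_add
  intro ε hε
  obtain ⟨L, hL, h⟩ := nd_one_le hLS p q hp hq (K := K + ε) (by linarith) (by linarith)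
  exact h.le.trans hL

lemma nd_one_ne {S : Type*} [MetricSpace S] (hLS : IsLengthSpace S) (p q : ℝ × S)
    (hp : p.1 ∈ Icc (0:ℝ) 2) (hq : q.1 ∈ Icc (0:ℝ) 2) :
    Nonempty (PiecewiseCausal (tWarp fun _ => (1:ℝ)) 0 2 p q) := by
  obtain ⟨L, _, h⟩ := nd_one_le hLS p q hp hq (K := |q.1 - p.1| + dist p.2 q.2 + 1)
    (by linarith [dist_nonneg (x := p.2) (y := q.2)]) (by linarith [abs_nonneg (q.1 - p.1)])
  obtain ⟨γ, _⟩ := h.curve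
  exact ⟨γ⟩

lemma nd_set_bdd {S : Type*} [MetricSpace S] (A B : Set S) :
    BddBelow {r : ℝ | ∃ a ∈ A, ∃ b ∈ B, r = dist a b} := by
  refine ⟨0, ?_⟩
  rintro r ⟨a, _, b, _, rfl⟩
  exact dist_nonneg

lemma nd_setDist_le {S : Type*} [MetricSpace S] (hLS : IsLengthSpace S) (p q : ℝ × S)
    (hp : p.1 ∈ Icc (0:ℝ) 2) (hq : q.1 ∈ Icc (0:ℝ) 2) (h : p.1 + q.1 ≤ dist p.2 q.2) :
    setDist {x : S | FutureRelated (tWarp fun _ => (1:ℝ)) ((0:ℝ), x) p}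
            {x : S | FutureRelated (tWarp fun _ => (1:ℝ)) ((0:ℝ), x) q} ≤
      dist p.2 q.2 - p.1 - q.1 := by
  apply le_of_forall_pos_le_add
  intro ε hε
  set D := dist p.2 q.2 + ε with hD
  have hp0 := hp.1
  have hq0 := hq.1
  have hD0 : 0 < D := by linarith
  obtain ⟨g, g0, g1, hg⟩ := nd_geod hLS p.2 q.2 D (by linarith)
  have e1 : D * (p.1 / D) = p.1 := by field_simp
  have e2 : D * (q.1 / D) = q.1 := by field_simp
  have l1 : p.1 / D ∈ Icc (0:ℝ) 1 := ⟨by positivity, (div_le_one hD0).2 (by linarith)⟩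
  have l2 : 1 - q.1 / D ∈ Icc (0:ℝ) 1 :=
    ⟨by linarith [(div_le_one hD0).2 (by linarith : q.1 ≤ D)],
      by linarith [div_nonneg hq0 hD0.le]⟩
  have hle : p.1 / D ≤ 1 - q.1 / D := by
    have : p.1 / D + q.1 / D ≤ 1 := by
      rw [← add_div]; exact (div_le_one hD0).2 (by linarith)
    linarith
  have s1 := nd_mk nd_one hD0 hg le_rfl hp.1 hp.2 one_pos (fun _ _ => le_rfl) l1
    ⟨le_rfl, zero_le_one⟩ (by rw [zero_sub, abs_neg, abs_of_nonneg l1.1, e1]; linarith)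
  have s2 := nd_mk nd_one hD0 hg le_rfl hq.1 hq.2 one_pos (fun _ _ => le_rfl) l2
    ⟨zero_le_one, le_rfl⟩ (by rw [sub_sub_cancel, abs_of_nonneg (by positivity), e2]; linarith)
  rw [g0] at s1
  rw [g1] at s2
  refine (csInf_le (nd_set_bdd _ _) ⟨g (p.1 / D), s1, g (1 - q.1 / D), s2, rfl⟩).trans ((hg _ _ l1.1 hle l2.2).trans ?_)
  rw [mul_sub, mul_sub, e1, e2]
  linarith

lemma nd_self_mem {S : Type*} [MetricSpace S] (p : ℝ × S) (hp : p.1 ∈ Icc (0:ℝ) 2) :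
    FutureRelated (tWarp fun _ => (1:ℝ)) ((0:ℝ), p.2) p := by
  have := nd_mk nd_one (g := fun _ => p.2) one_pos (by intro s t _ _ _; simp; linarith) le_rfl hp.1 hp.2
    one_pos (fun _ _ => le_rfl) (s₀ := 0) (s₁ := 0) ⟨le_rfl, zero_le_one⟩ ⟨le_rfl, zero_le_one⟩
    (by simpa using hp.1)
  exact this

/-- quantitative two-sided estimate -/
lemma nd_main {S : Type*} [MetricSpace S] (hLS : IsLengthSpace S) {f : ℝ → ℝ} (hf : NdOK f)
    {h δ δ' : ℝ} (hh : 0 < h) (hh1 : h < 1) (hδ : 0 ≤ δ) (hδ' : 0 < δ') (hδ2 : δ' ≤ 2)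
    (hfh : ∀ t ∈ Icc (0:ℝ) 2, h ≤ f t) (hfle : ∀ t ∈ Icc (0:ℝ) 2, f t ≤ 1)
    (hf1 : ∀ t ∈ Icc δ 2, 1 ≤ f t) (hf0 : ∀ t ∈ Icc 0 δ', f t ≤ h)
    (p q : ℝ × S) (hp : p.1 ∈ Icc (0:ℝ) 2) (hq : q.1 ∈ Icc (0:ℝ) 2) :
    |nullDist (tWarp f) (fun p => p.1) 0 2 p q -
      min (nullDist (tWarp fun _ => (1:ℝ)) (fun p => p.1) 0 2 p q)
          (p.1 + q.1 + h * setDist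
            {x : S | FutureRelated (tWarp fun _ => (1:ℝ)) ((0:ℝ), x) p}
            {x : S | FutureRelated (tWarp fun _ => (1:ℝ)) ((0:ℝ), x) q})| ≤ 2 * δ := by
  set R := setDist {x : S | FutureRelated (tWarp fun _ => (1:ℝ)) ((0:ℝ), x) p}
            {x : S | FutureRelated (tWarp fun _ => (1:ℝ)) ((0:ℝ), x) q} with hR
  have tr : ∀ p q : ℝ × S, p.1 ∈ Icc (0:ℝ) 2 → q.1 ∈ Icc (0:ℝ) 2 →
      CausallyRelated (tWarp fun _ => (1:ℝ)) p q → CausallyRelated (tWarp f) p q := by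
    rintro p q hp hq (h | h)
    · exact Or.inl (nd_transfer hf hfle hp.1 hq.2 h)
    · exact Or.inr (nd_transfer hf hfle hq.1 hp.2 h)
  have trc : ∀ γ : PiecewiseCausal (tWarp fun _ => (1:ℝ)) 0 2 p q,
      ∃ γ' : PiecewiseCausal (tWarp f) 0 2 p q,
        nullLength (fun p => p.1) γ = nullLength (fun p => p.1) γ' := fun γ =>
    ⟨⟨γ.k, γ.hk, γ.pt, γ.h0, γ.hlast, γ.hstrip, fun i hi =>
      tr _ _ (γ.hstrip i hi.le) (γ.hstrip (i+1) hi) (γ.piece i hi)⟩, rfl⟩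
  obtain ⟨γ₀⟩ := nd_one_ne hLS p q hp hq
  have up1 : nullDist (tWarp f) (fun p => p.1) 0 2 p q ≤
      nullDist (tWarp fun _ => (1:ℝ)) (fun p => p.1) 0 2 p q := by
    refine le_csInf ⟨_, γ₀, rfl⟩ ?_
    rintro L ⟨γ, rfl⟩
    obtain ⟨γ', hγ'⟩ := trc γ
    exact csInf_le nd_bdd ⟨γ', hγ'⟩
  have up2 : nullDist (tWarp f) (fun p => p.1) 0 2 p q ≤ p.1 + q.1 + h * R := by
    have : (nullDist (tWarp f) (fun p => p.1) 0 2 p q - p.1 - q.1) / h ≤ R := by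
      refine le_csInf ⟨_, p.2, nd_self_mem p hp, q.2, nd_self_mem q hq, rfl⟩ ?_
      rintro r ⟨a, ha, b, hb, rfl⟩
      apply le_of_forall_pos_le_add
      intro ε hε
      obtain ⟨g, g0, g1, hg⟩ := nd_geod hLS a b (dist a b + ε) (by linarith)
      have hD0 : 0 < dist a b + ε := by linarith [dist_nonneg (x := a) (y := b)]
      have z := nd_zig hf hD0 hg le_rfl hδ' hδ2 hh hf0 ⟨le_rfl, zero_le_one⟩
      rw [g0, g1] at z
      have i0 : (0:ℝ) ∈ Icc (0:ℝ) 2 := ⟨le_rfl, zero_le_two⟩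
      have r := (NdReach.single hp i0 (tr p (0, a) hp i0 (Or.inr ha))).tr
        (z.tr (NdReach.single i0 hq (tr (0, b) q i0 hq (Or.inl hb))))
      have := r.le
      dsimp only at this
      rw [zero_sub, abs_neg, sub_zero, sub_zero, abs_of_nonneg hp.1, abs_of_nonneg hq.1] at this
      rw [div_le_iff₀ hh]
      linarith
    rw [div_le_iff₀ hh] at this
    linarith
  have low : min (nullDist (tWarp fun _ => (1:ℝ)) (fun p => p.1) 0 2 p q)
          (p.1 + q.1 + h * R) - 2 * δ ≤ nullDist (tWarp f) (fun p => p.1) 0 2 p q := by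
    obtain ⟨γ₁, _⟩ := trc γ₀
    refine le_csInf ⟨_, γ₁, rfl⟩ ?_
    rintro L ⟨γ, rfl⟩
    obtain ⟨ht, M, N, hM, hN, hL, hd, hor⟩ := nd_lower hf hh hfh hf1 γ
    set L := nullLength (fun p => p.1) γ
    rw [sub_le_iff_le_add]
    rcases hor with rfl | hor
    · refine (min_le_left _ _).trans (nd_one_le' hLS p q hp hq (by linarith) ?_)
      rw [zero_div] at hd
      linarith
    · have hd' : h * dist p.2 q.2 ≤ h * M + N := by
        calc _ ≤ h * (M + N / h) := by gcongr
          _ = _ := by field_simp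
      have hLM : (1 - h) * (p.1 + q.1 - 2 * δ) ≤ (1 - h) * M := by
        apply mul_le_mul_of_nonneg_left hor (by linarith)
      have hhδ : 0 ≤ h * δ := by positivity
      rcases le_total (p.1 + q.1) (dist p.2 q.2) with hc | hc
      · refine (min_le_right _ _).trans ?_
        have := mul_le_mul_of_nonneg_left (nd_setDist_le hLS p q hp hq hc) hh.le
        rw [← hR] at this
        linarith
      · refine (min_le_left _ _).trans (nd_one_le' hLS p q hp hq (by linarith) ?_)
        have := mul_le_mul_of_nonneg_left hc (by linarith : 0 ≤ 1 - h)
        linarith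
  rw [abs_le]
  exact ⟨by linarith, by linarith [le_min up1 up2]⟩

end NullDistPaper

/-- **Example 3.1 (Allen–Burtscher shortcut example, `Ex-Shortcut`).**
Fix a compact (Riemannian, i.e. length) metric space `(Σ,σ)` and `0 < h₀ < 1`.
On `M = [0,2] × Σ` let `fⱼ : [0,2] → (0,1]` be continuous with `fⱼ = h₀` on
`[0, 1/(j+1)]`, `fⱼ = 1` on `[1/j, 2]`, increasing from `h₀` to `1` on
`[1/(j+1), 1/j]`, and `gⱼ = -dt² + fⱼ²σ`, `g = -dt² + σ`.  Then the null
distances `d̂_{t,gⱼ}` converge uniformly to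
`d₀(p,q) = min{ d̂_{t,g}(p,q), t(p) + t(q) + h₀·d_σ((J⁻_g(p) ∩ Σ₀)_Σ, (J⁻_g(q) ∩ Σ₀)_Σ) }`,
and `d₀ ≠ d̂_{t,g}`, so `d̂_{t,gⱼ}` does not converge to `d̂_{t,g}`. -/
theorem nullDist_shortcut_example
    {S : Type*} [MetricSpace S] [CompactSpace S] [ConnectedSpace S] [Nontrivial S]
    (hLS : IsLengthSpace S)
    (h₀ : ℝ) (hh₀ : 0 < h₀ ∧ h₀ < 1)
    (f : ℕ → ℝ → ℝ)
    (hfc : ∀ j : ℕ, 1 ≤ j → ContinuousOn (f j) (Set.Icc 0 2))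
    (hfa : ∀ j : ℕ, 1 ≤ j → ∀ t ∈ Set.Icc (0:ℝ) (1 / (j + 1 : ℝ)), f j t = h₀)
    (hfb : ∀ j : ℕ, 1 ≤ j → ∀ t ∈ Set.Icc (1 / (j : ℝ)) 2, f j t = 1)
    (hfmono : ∀ j : ℕ, 1 ≤ j → MonotoneOn (f j) (Set.Icc (1 / (j + 1 : ℝ)) (1 / (j : ℝ))))
    (hfrange : ∀ j : ℕ, 1 ≤ j → ∀ t ∈ Set.Icc (0:ℝ) 2, h₀ ≤ f j t ∧ f j t ≤ 1) :
    -- the limit metric `d₀`: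
    ∀ d₀ : ℝ × S → ℝ × S → ℝ,
      (∀ p q : ℝ × S, d₀ p q =
        min (nullDist (tWarp fun _ => (1:ℝ)) (fun p => p.1) 0 2 p q)
          (p.1 + q.1 + h₀ * setDist
            {x : S | FutureRelated (tWarp fun _ => (1:ℝ)) ((0:ℝ), x) p}
            {x : S | FutureRelated (tWarp fun _ => (1:ℝ)) ((0:ℝ), x) q})) →
      -- uniform convergence `d̂_{t,gⱼ} → d₀`:
      ((∀ ε > 0, ∃ N : ℕ, ∀ j ≥ N, ∀ p q : ℝ × S,
        p.1 ∈ Set.Icc (0:ℝ) 2 → q.1 ∈ Set.Icc (0:ℝ) 2 →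
        |nullDist (tWarp (f j)) (fun p => p.1) 0 2 p q - d₀ p q| ≤ ε) ∧
      -- and `d₀ ≠ d̂_{t,g}`:
      ∃ p q : ℝ × S, p.1 ∈ Set.Icc (0:ℝ) 2 ∧ q.1 ∈ Set.Icc (0:ℝ) 2 ∧
        d₀ p q ≠ nullDist (tWarp fun _ => (1:ℝ)) (fun p => p.1) 0 2 p q) := by
  intro d₀ hd₀
  obtain ⟨hh, hh1⟩ := hh₀
  constructor
  · intro ε hε
    obtain ⟨N, hN⟩ := exists_nat_gt (2 / ε)
    refine ⟨N + 1, fun j hj p q hp hq => ?_⟩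
    have hj1 : 1 ≤ j := by omega
    have hj' : (N:ℝ) + 1 ≤ j := by exact_mod_cast hj
    have hj0 : (0:ℝ) < j := by exact_mod_cast hj1
    have hj1' : (1:ℝ) ≤ j := by exact_mod_cast hj1
    rw [hd₀]
    refine (nd_main hLS (f := f j) ⟨hfc j hj1, fun t ht => hh.trans_le (hfrange j hj1 t ht).1⟩
      (h := h₀) (δ := 1 / j) (δ' := 1 / (j + 1)) hh hh1 (by positivity) (by positivity) ?_
      (fun t ht => (hfrange j hj1 t ht).1) (fun t ht => (hfrange j hj1 t ht).2)
      (fun t ht => (hfb j hj1 t ht).ge) (fun t ht => (hfa j hj1 t ht).le) p q hp hq).trans ?_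
    · rw [div_le_iff₀ (by positivity)]; linarith
    · rw [div_lt_iff₀ hε] at hN
      rw [mul_one_div, div_le_iff₀ hj0]
      nlinarith
  · obtain ⟨x, y, hxy⟩ := exists_pair_ne S
    have i0 : (0:ℝ) ∈ Set.Icc (0:ℝ) 2 := ⟨le_rfl, zero_le_two⟩
    refine ⟨(0, x), (0, y), i0, i0, ?_⟩
    have hpos := dist_pos.2 hxy
    have h1 : dist x y ≤ nullDist (tWarp fun _ => (1:ℝ)) (fun p => p.1) 0 2 ((0:ℝ), x) ((0:ℝ), y) := by
      obtain ⟨γ₀⟩ := nd_one_ne hLS ((0:ℝ), x) ((0:ℝ), y) i0 i0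
      refine le_csInf ⟨_, γ₀, rfl⟩ ?_
      rintro L ⟨γ, rfl⟩
      obtain ⟨_, M, N, _, _, hL, hd, _⟩ := nd_lower nd_one (h := 1) (δ := 0) one_pos
        (fun _ _ => le_rfl) (fun _ _ => le_rfl) γ
      rw [div_one] at hd
      rw [hL]; exact hd
    have h2 := mul_le_mul_of_nonneg_left
      (nd_setDist_le hLS ((0:ℝ), x) ((0:ℝ), y) i0 i0 (by simp)) hh.le
    apply ne_of_lt
    rw [hd₀]
    refine (min_le_right _ _).trans_lt (lt_of_le_of_lt (b := h₀ * dist x y) ?_ (lt_of_lt_of_le ?_ h1))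
    · simp only [sub_zero] at h2
      simpa using h2
    · nlinarith
end

section
/- Let (𝔻ⁿ,σ) be the flat unit disk and, for η ∈ (0,∞) and j ≥ 2, let f_j : [0,1] → [1,∞) be continuous with f_j(t) = j^η for t ∈ [0, 1/(2j)], f_j(t) = h_j(t) for t ∈ [1/(2j), 1/j] where h_j is any continuous decreasing function with h_j(1/(2j)) = j^η and h_j(1/j) = 1, and f_j(t) = 1 otherwise. Set g_j = −dt² + f_j²σ and g₀ = −dt² + σ on M = [0,1] × 𝔻ⁿ. Then d̂_{t,g₀}(p,q) ≤ d̂_{t,g_j}(p,q) ≤ d̂_{t,g₀}(p,q) + 2/j for all p, q ∈ M; in particular d̂_{t,g_j} → d̂_{t,g₀} uniformly, regardless of the blow-up rate η. -/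
open Set MeasureTheory Filter Topology

open NullDistPaper Set Filter

namespace NullDistPaper

/-- The flat unit disk `𝔻ⁿ ⊆ ℝⁿ` (with its flat, i.e. Euclidean, metric). -/
abbrev Disk (n : ℕ) : Type := (Metric.closedBall (0 : EuclideanSpace ℝ (Fin n)) 1 : Set _)

end NullDistPaper

namespace NullDistPaper

def Reach {S : Type*} [PseudoMetricSpace S] (f : ℝ → S → ℝ) (p q : ℝ × S) (L : ℝ) : Prop :=
  ∃ γ : PiecewiseCausal f 0 1 p q, nullLength (fun p => p.1) γ = L

lemma reach_single {S : Type*} [PseudoMetricSpace S] {f : ℝ → S → ℝ} {p q : ℝ × S}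
    (hp : p.1 ∈ Icc (0:ℝ) 1) (hq : q.1 ∈ Icc (0:ℝ) 1) (h : CausallyRelated f p q) :
    Reach f p q |q.1 - p.1| := by
  refine ⟨⟨1, one_pos, fun i => if i = 0 then p else q, by simp, by simp, ?_, ?_⟩, ?_⟩
  · intro i hi
    by_cases h0 : i = 0 <;> simp only [h0, if_true, if_false] <;> assumption
  · intro i hi
    have : i = 0 := by omega
    subst this
    simpa using h
  · simp [nullLength]

lemma reach_trans {S : Type*} [PseudoMetricSpace S] {f : ℝ → S → ℝ} {p q r : ℝ × S} {L L' : ℝ}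
    (h : Reach f p q L) (h' : Reach f q r L') : Reach f p r (L + L') := by
  obtain ⟨γ, hγ⟩ := h
  obtain ⟨δ, hδ⟩ := h'
  have key : ∀ i, (fun i => if i ≤ γ.k then γ.pt i else δ.pt (i - γ.k)) (γ.k + i) = δ.pt i := by
    intro i
    by_cases h0 : i = 0
    · subst h0
      simp [γ.hlast, δ.h0]
    · have : ¬ (γ.k + i ≤ γ.k) := by omega
      simp [h0]
  have key2 : ∀ i ≤ γ.k, (fun i => if i ≤ γ.k then γ.pt i else δ.pt (i - γ.k)) i = γ.pt i := by
    intro i hi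
    simp [hi]
  generalize (fun i => if i ≤ γ.k then γ.pt i else δ.pt (i - γ.k)) = P at key key2
  refine ⟨⟨γ.k + δ.k, by have := γ.hk; omega, P, ?_, ?_, ?_, ?_⟩, ?_⟩
  · rw [key2 0 (Nat.zero_le _), γ.h0]
  · rw [key, δ.hlast]
  · intro i hi
    rcases le_total i γ.k with h1 | h1
    · rw [key2 i h1]; exact γ.hstrip i h1
    · obtain ⟨m, rfl⟩ := Nat.exists_eq_add_of_le h1
      rw [key]; exact δ.hstrip m (by omega)
  · intro i hi
    rcases lt_or_ge i γ.k with h1 | h1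
    · rw [key2 i h1.le, key2 (i+1) h1]; exact γ.piece i h1
    · obtain ⟨m, rfl⟩ := Nat.exists_eq_add_of_le h1
      rw [add_assoc, key, key]; exact δ.piece m (by omega)
  · rw [← hγ, ← hδ]
    simp only [nullLength]
    rw [Finset.sum_range_add]
    congr 1
    · refine Finset.sum_congr rfl fun i hi => ?_
      have := Finset.mem_range.1 hi
      rw [key2 i (by omega), key2 (i+1) (by omega)]
    · refine Finset.sum_congr rfl fun i hi => ?_
      rw [add_assoc, key, key]

lemma future_vertical {S : Type*} [PseudoMetricSpace S] (f : ℝ → S → ℝ) {s t : ℝ} (h : s ≤ t)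
    (x : S) : FutureRelated f (s, x) (t, x) := by
  refine ⟨h, fun _ => x, rfl, rfl, h, continuousOn_const, ?_⟩
  intro c _ d _ _
  have : eVariationOn (fun _ : ℝ => x) (Icc c d) = 0 := by
    apply eVariationOn.constant_on
    rintro a ⟨_, _, rfl⟩ b ⟨_, _, rfl⟩
    rfl
  rw [this]
  exact zero_le

lemma disk_between {n : ℕ} (x y : Disk n) {u : ℝ} (hu : u ∈ Icc (0:ℝ) 1) :
    ∃ z : Disk n, dist x z = u * dist x y ∧ dist z y = (1 - u) * dist x y := by
  refine ⟨⟨AffineMap.lineMap (x : EuclideanSpace ℝ (Fin n)) y u,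
    (convex_closedBall _ _).lineMap_mem x.2 y.2 hu⟩, ?_, ?_⟩
  · rw [Subtype.dist_eq, Subtype.dist_eq, dist_left_lineMap, Real.norm_of_nonneg hu.1]
  · rw [Subtype.dist_eq, Subtype.dist_eq, dist_lineMap_right,
      Real.norm_of_nonneg (by linarith [hu.2])]

lemma future_line {n : ℕ} {g : ℝ → ℝ} {a s t : ℝ} (hg : ∀ r ∈ Icc a 1, g r = 1)
    (hs : a ≤ s) (ht : t ≤ 1) (hst : s ≤ t) (x y : Disk n) (hxy : dist x y ≤ t - s) :
    FutureRelated (tWarp g) (s, x) (t, y) := by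
  rcases hst.eq_or_lt with rfl | hlt
  · have : x = y := dist_le_zero.1 (by linarith)
    subst this
    exact future_vertical _ le_rfl x
  have hpos : 0 < t - s := by linarith
  have hmem : ∀ r : Icc s t, ((r:ℝ) - s) / (t - s) ∈ Icc (0:ℝ) 1 := fun r =>
    ⟨div_nonneg (by linarith [r.2.1]) hpos.le, (div_le_one hpos).2 (by linarith [r.2.2])⟩
  let F : Icc s t → Disk n := fun r =>
    ⟨AffineMap.lineMap (x : EuclideanSpace ℝ (Fin n)) y (((r:ℝ) - s) / (t - s)),
    (convex_closedBall _ _).lineMap_mem x.2 y.2 (hmem r)⟩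
  have hF : LipschitzWith 1 F := by
    refine LipschitzWith.of_dist_le_mul fun r r' => ?_
    rw [Subtype.dist_eq, dist_lineMap_lineMap, Subtype.dist_eq r r', Real.dist_eq, Real.dist_eq,
      ← Subtype.dist_eq x y, ← sub_div, abs_div, abs_of_pos hpos, NNReal.coe_one, one_mul,
      div_mul_eq_mul_div, div_le_iff₀ hpos]
    have : (r:ℝ) - s - (r' - s) = r - r' := by ring
    rw [this]
    gcongr
  have hG : LipschitzWith 1 (F ∘ projIcc s t hst) := by
    simpa using hF.comp (LipschitzWith.projIcc hst)
  refine ⟨hst, F ∘ projIcc s t hst, ?_, ?_, hst, hG.continuous.continuousOn, ?_⟩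
  · simp [F]
  · simp [F, hpos.ne']
  · intro c hc d hd hcd
    have hc1 : s ≤ c := hc.1
    have hd1 : d ≤ t := hd.2
    have h1 : ∫ r in c..d, 1 / tWarp g r ((F ∘ projIcc s t hst) r) = d - c := by
      have : ∫ r in c..d, 1 / tWarp g r ((F ∘ projIcc s t hst) r) = ∫ r in c..d, (1:ℝ) := by
        refine intervalIntegral.integral_congr fun r hr => ?_
        rw [uIcc_of_le hcd] at hr
        simp only [tWarp]
        rw [hg r ⟨by linarith [hr.1], by linarith [hr.2]⟩, div_one]
      rw [this]; simp
    rw [h1]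
    have h2 := (hG.lipschitzOnWith (s := univ)).comp_eVariationOn_le
      (g := (id : ℝ → ℝ)) (s := Icc c d) (mapsTo_univ _ _)
    have h3 := (monotone_id.monotoneOn (Icc c d)).eVariationOn_le
      (left_mem_Icc.2 hcd) (right_mem_Icc.2 hcd)
    simp only [inter_self, id] at h3
    simpa using h2.trans (by simpa using h3)

lemma causal_line {n : ℕ} {g : ℝ → ℝ} {a s t : ℝ} (hg : ∀ r ∈ Icc a 1, g r = 1)
    (hs : s ∈ Icc a 1) (ht : t ∈ Icc a 1) (x y : Disk n) (hxy : dist x y ≤ |t - s|) :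
    CausallyRelated (tWarp g) (s, x) (t, y) := by
  rcases le_total s t with h | h
  · rw [abs_of_nonneg (by linarith)] at hxy
    exact Or.inl (future_line hg hs.1 ht.2 h x y hxy)
  · rw [abs_of_nonpos (by linarith)] at hxy
    rw [dist_comm] at hxy
    exact Or.inr (future_line hg ht.1 hs.2 h y x (by linarith))

lemma reach_line {n : ℕ} {g : ℝ → ℝ} {a s t : ℝ} (ha : 0 ≤ a) (hg : ∀ r ∈ Icc a 1, g r = 1)
    (hs : s ∈ Icc a 1) (ht : t ∈ Icc a 1) (x y : Disk n) (hxy : dist x y ≤ |t - s|) :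
    Reach (tWarp g) (s, x) (t, y) |t - s| :=
  reach_single (p := (s, x)) (q := (t, y)) ⟨ha.trans hs.1, hs.2⟩ ⟨ha.trans ht.1, ht.2⟩
    (causal_line hg hs ht x y hxy)

lemma reach_zigzag {n : ℕ} {g : ℝ → ℝ} {a s t : ℝ} (ha : 0 ≤ a) (hg : ∀ r ∈ Icc a 1, g r = 1)
    (hs : s ∈ Icc a 1) (ht : t ∈ Icc a 1) (N : ℕ) : ∀ (x y : Disk n),
    dist x y ≤ (N + 1) * (2 * |t - s|) →
    Reach (tWarp g) (s, x) (s, y) ((N + 1) * (2 * |t - s|)) := by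
  have one : ∀ x y : Disk n, dist x y ≤ 2 * |t - s| →
      Reach (tWarp g) (s, x) (s, y) (2 * |t - s|) := by
    intro x y h
    obtain ⟨z, h1, h2⟩ := disk_between x y (u := 1/2) ⟨by norm_num, by norm_num⟩
    have e1 := reach_line ha hg hs ht x z (by linarith)
    have e2 := reach_line ha hg ht hs z y (by rw [abs_sub_comm]; linarith)
    have := reach_trans e1 e2
    rwa [abs_sub_comm s t, ← two_mul] at this
  induction N with
  | zero => intro x y h; simpa using one x y (by simpa using h)
  | succ N ih =>
    intro x y h
    push_cast at h ⊢
    have hN : (0:ℝ) < N + 1 + 1 := by positivity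
    obtain ⟨z, h1, h2⟩ := disk_between x y (u := (N + 1) / (N + 1 + 1))
      ⟨by positivity, (div_le_one hN).2 (by linarith)⟩
    have h3 : dist x y / (N + 1 + 1) ≤ 2 * |t - s| := by
      rw [div_le_iff₀ hN]; linarith
    have e1 := ih x z (by
      rw [h1, div_mul_eq_mul_div, mul_div_assoc]; gcongr)
    have e2 := one z y (by
      rw [h2]
      have : (1 - ((N:ℝ) + 1) / (N + 1 + 1)) * dist x y = dist x y / (N + 1 + 1) := by
        field_simp; ring
      rw [this]; exact h3)
    have := reach_trans e1 e2
    convert this using 1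
    ring

lemma reach_level {n : ℕ} {g : ℝ → ℝ} {a s : ℝ} (ha : 0 ≤ a) (ha1 : a < 1)
    (hg : ∀ r ∈ Icc a 1, g r = 1)
    (hs : s ∈ Icc a 1) (x y : Disk n) :
    Reach (tWarp g) (s, x) (s, y) (dist x y) := by
  obtain ⟨N, hN⟩ := exists_nat_gt (dist x y / (1 - a))
  have hE : (0:ℝ) ≤ dist x y := dist_nonneg
  have hN0 : (0:ℝ) < N + 1 := by positivity
  set δ := dist x y / (2 * (N + 1)) with hδ
  have hδ0 : 0 ≤ δ := by positivity
  have hδ1 : 2 * δ ≤ 1 - a := by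
    rw [div_lt_iff₀ (by linarith)] at hN
    have : 2 * δ = dist x y / (N + 1) := by rw [hδ]; field_simp
    rw [this, div_le_iff₀ hN0]
    nlinarith
  have hsum : ((N:ℝ) + 1) * (2 * δ) = dist x y := by rw [hδ]; field_simp
  obtain ⟨t, ht, hts⟩ : ∃ t ∈ Icc a 1, |t - s| = δ := by
    rcases le_total (s + δ) 1 with h | h
    · exact ⟨s + δ, ⟨by linarith [hs.1], h⟩, by simp [abs_of_nonneg hδ0]⟩
    · exact ⟨s - δ, ⟨by linarith [hs.1], by linarith [hs.2]⟩, by simp [abs_of_nonneg hδ0]⟩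
  have := reach_zigzag ha hg hs ht N x y (by rw [hts, hsum])
  rwa [hts, hsum] at this

lemma reach_max {n : ℕ} {g : ℝ → ℝ} {a s t : ℝ} (ha : 0 ≤ a) (ha1 : a < 1)
    (hg : ∀ r ∈ Icc a 1, g r = 1)
    (hs : s ∈ Icc a 1) (ht : t ∈ Icc a 1) (x y : Disk n) :
    Reach (tWarp g) (s, x) (t, y) (max |t - s| (dist x y)) := by
  rcases le_total (dist x y) |t - s| with h | h
  · rw [max_eq_left h]; exact reach_line ha hg hs ht x y h
  · rw [max_eq_right h]
    rcases (dist_nonneg (x := x) (y := y)).eq_or_lt with h0 | h0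
    · have e := reach_line ha hg hs ht x y (by rw [← h0]; positivity)
      rwa [le_antisymm h (by rw [← h0]; positivity)] at e
    obtain ⟨z, h1, h2⟩ := disk_between x y (u := (dist x y - |t - s|) / dist x y)
      ⟨div_nonneg (by linarith) h0.le, (div_le_one h0).2 (by linarith [abs_nonneg (t - s)])⟩
    have h1' : dist x z = dist x y - |t - s| := by rw [h1]; field_simp
    have h2' : dist z y = |t - s| := by rw [h2]; field_simp; ring
    have := reach_trans (reach_level ha ha1 hg hs x z) (reach_line ha hg hs ht z y h2'.le)
    rwa [h1', sub_add_cancel] at this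

lemma dist_le_of_causal {S : Type*} [PseudoMetricSpace S] {p q : ℝ × S}
    (h : CausallyRelated (tWarp fun _ => (1:ℝ)) p q) : dist p.2 q.2 ≤ |q.1 - p.1| := by
  have key : ∀ p q : ℝ × S, FutureRelated (tWarp fun _ => (1:ℝ)) p q →
      dist p.2 q.2 ≤ q.1 - p.1 := by
    rintro p q ⟨hpq, x, hp, hq, -, -, hv⟩
    have h1 := hv p.1 (left_mem_Icc.2 hpq) q.1 (right_mem_Icc.2 hpq) hpq
    have h2 := eVariationOn.edist_le x (left_mem_Icc.2 hpq) (right_mem_Icc.2 hpq)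
    have h3 := h2.trans h1
    simp only [tWarp, hp, hq, edist_dist] at h3
    simpa using (ENNReal.ofReal_le_ofReal_iff (by simpa using hpq)).1 h3
  rcases h with h | h
  · exact (key _ _ h).trans (le_abs_self _)
  · have := key _ _ h
    rw [dist_comm]
    exact this.trans (by rw [abs_sub_comm]; exact le_abs_self _)

lemma max_le_length {S : Type*} [PseudoMetricSpace S] {p q : ℝ × S}
    (γ : PiecewiseCausal (tWarp fun _ => (1:ℝ)) 0 1 p q) :
    max |q.1 - p.1| (dist p.2 q.2) ≤ nullLength (fun p => p.1) γ := by
  have h : ∀ i ≤ γ.k, max |(γ.pt i).1 - p.1| (dist p.2 (γ.pt i).2) ≤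
      ∑ i ∈ Finset.range i, |(γ.pt (i + 1)).1 - (γ.pt i).1| := by
    intro i
    induction i with
    | zero => intro _; simp [γ.h0]
    | succ i ih =>
      intro hi
      have h1 := ih (by omega)
      rw [Finset.sum_range_succ]
      have h2 := dist_le_of_causal (γ.piece i (by omega))
      have h3 := (le_max_left _ _).trans h1
      have h4 := (le_max_right _ _).trans h1
      refine max_le ?_ ?_
      · have := abs_sub_le (γ.pt (i+1)).1 (γ.pt i).1 p.1
        linarith
      · have := dist_triangle p.2 (γ.pt i).2 (γ.pt (i+1)).2
        linarith
  have := h γ.k le_rfl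
  rwa [γ.hlast] at this

lemma future_mono {S : Type*} [PseudoMetricSpace S] {g : ℝ → ℝ}
    (hgc : ContinuousOn g (Icc 0 1)) (hg1 : ∀ t ∈ Icc (0:ℝ) 1, 1 ≤ g t) {p q : ℝ × S}
    (hp : p.1 ∈ Icc (0:ℝ) 1) (hq : q.1 ∈ Icc (0:ℝ) 1) (h : FutureRelated (tWarp g) p q) :
    FutureRelated (tWarp fun _ => (1:ℝ)) p q := by
  obtain ⟨hpq, x, h1, h2, h3, h4, h5⟩ := h
  refine ⟨hpq, x, h1, h2, h3, h4, fun c hc d hd hcd => (h5 c hc d hd hcd).trans ?_⟩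
  apply ENNReal.ofReal_le_ofReal
  have hsub : Icc c d ⊆ Icc (0:ℝ) 1 := Icc_subset_Icc (hp.1.trans hc.1) (hd.2.trans hq.2)
  simp only [tWarp]
  refine intervalIntegral.integral_mono_on hcd ?_ (by simp) ?_
  · apply ContinuousOn.intervalIntegrable
    rw [uIcc_of_le hcd]
    refine continuousOn_const.div (hgc.mono hsub) fun t ht => ?_
    have := hg1 t (hsub ht)
    linarith
  · intro t ht
    have := hg1 t (hsub ht)
    gcongr

lemma nullDist_le_of_reach {S : Type*} [PseudoMetricSpace S] {f : ℝ → S → ℝ} {p q : ℝ × S} {L : ℝ}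
    (h : Reach f p q L) : nullDist f (fun p => p.1) 0 1 p q ≤ L := by
  obtain ⟨γ, hγ⟩ := h
  refine csInf_le ⟨0, ?_⟩ ⟨γ, hγ.symm⟩
  rintro _ ⟨γ, rfl⟩
  exact Finset.sum_nonneg fun _ _ => abs_nonneg _

lemma le_nullDist {S : Type*} [PseudoMetricSpace S] {f : ℝ → S → ℝ} {p q : ℝ × S} {L B : ℝ}
    (h : Reach f p q L) (hB : ∀ γ : PiecewiseCausal f 0 1 p q, B ≤ nullLength (fun p => p.1) γ) :
    B ≤ nullDist f (fun p => p.1) 0 1 p q := by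
  obtain ⟨γ, hγ⟩ := h
  refine le_csInf ⟨_, γ, rfl⟩ ?_
  rintro _ ⟨γ, rfl⟩
  exact hB γ

lemma abs_max_sub (a s t : ℝ) : |max t a - max s a| ≤ |t - s| := by
  simpa using abs_max_sub_max_le_max t a s a

lemma main_bound {n : ℕ} {g : ℝ → ℝ} {a : ℝ} (ha : 0 ≤ a) (ha1 : a < 1)
    (hgc : ContinuousOn g (Icc 0 1)) (hg : ∀ r ∈ Icc a 1, g r = 1)
    (hg1 : ∀ t ∈ Icc (0:ℝ) 1, 1 ≤ g t) (p q : ℝ × Disk n)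
    (hp : p.1 ∈ Icc (0:ℝ) 1) (hq : q.1 ∈ Icc (0:ℝ) 1) :
    nullDist (tWarp fun _ => (1:ℝ)) (fun p => p.1) 0 1 p q ≤
        nullDist (tWarp g) (fun p => p.1) 0 1 p q ∧
      nullDist (tWarp g) (fun p => p.1) 0 1 p q ≤
        nullDist (tWarp fun _ => (1:ℝ)) (fun p => p.1) 0 1 p q + 2 * a := by
  obtain ⟨s, x⟩ := p
  obtain ⟨t, y⟩ := q
  simp only at hp hq
  have hs' : max s a ∈ Icc a 1 := ⟨le_max_right _ _, max_le hp.2 ha1.le⟩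
  have ht' : max t a ∈ Icc a 1 := ⟨le_max_right _ _, max_le hq.2 ha1.le⟩
  have e1 : Reach (tWarp g) (s, x) (max s a, x) |max s a - s| :=
    reach_single (p := (s, x)) (q := (max s a, x)) hp ⟨ha.trans hs'.1, hs'.2⟩
      (Or.inl (future_vertical _ (le_max_left _ _) x))
  have e3 : Reach (tWarp g) (max t a, y) (t, y) |t - max t a| :=
    reach_single (p := (max t a, y)) (q := (t, y)) ⟨ha.trans ht'.1, ht'.2⟩ hq
      (Or.inr (future_vertical _ (le_max_left _ _) y))
  have e := reach_trans (reach_trans e1 (reach_max ha ha1 hg hs' ht' x y)) e3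
  have e0 := reach_max (g := fun _ => (1:ℝ)) le_rfl zero_lt_one (fun _ _ => rfl) hp hq x y
  refine ⟨le_nullDist e fun γ => ?_, ?_⟩
  · refine nullDist_le_of_reach ⟨⟨γ.k, γ.hk, γ.pt, γ.h0, γ.hlast, γ.hstrip, fun i hi => ?_⟩, rfl⟩
    have h1 := γ.hstrip i hi.le
    have h2 := γ.hstrip (i+1) hi
    exact (γ.piece i hi).imp (future_mono hgc hg1 h1 h2) (future_mono hgc hg1 h2 h1)
  · have h1 := nullDist_le_of_reach e
    have h0 := le_nullDist e0 max_le_length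
    simp only at h0
    have h2 : |max s a - s| ≤ a := by
      rw [abs_of_nonneg (by linarith [le_max_left s a])]
      have : max s a ≤ s + a := max_le (by linarith) (by linarith [hp.1])
      linarith
    have h3 : |t - max t a| ≤ a := by
      rw [abs_of_nonpos (by linarith [le_max_left t a])]
      have : max t a ≤ t + a := max_le (by linarith) (by linarith [hq.1])
      linarith
    have h4 := max_le_max_right (dist x y) (abs_max_sub a s t)
    linarith

end NullDistPaper

/-- **Example 3.2 (`Ex:BlowUpNoEffect`): blow up which does not affect the
sequence.**  Let `(𝔻ⁿ,σ)` be the flat disk and, for `η ∈ (0,∞)`, let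
`fⱼ : [0,1] → [1,∞)` be continuous with `fⱼ = jᵑ` on `[0, 1/(2j)]`, `fⱼ = hⱼ`
decreasing on `[1/(2j), 1/j]`, and `fⱼ = 1` otherwise.  With
`gⱼ = -dt² + fⱼ²σ` and `g₀ = -dt² + σ` on `M = [0,1] × 𝔻ⁿ`, we have
`d̂_{t,g₀} ≤ d̂_{t,gⱼ} ≤ d̂_{t,g₀} + 2/j`; in particular `d̂_{t,gⱼ} → d̂_{t,g₀}`
uniformly, regardless of the blow-up rate `η`. -/
theorem nullDist_blowup_no_effect
    (n : ℕ) (η : ℝ) (hη : 0 < η)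
    (f : ℕ → ℝ → ℝ)
    (hfc : ∀ j : ℕ, 2 ≤ j → ContinuousOn (f j) (Set.Icc 0 1))
    (hfa : ∀ j : ℕ, 2 ≤ j → ∀ t ∈ Set.Icc (0:ℝ) (1 / (2 * (j:ℝ))), f j t = (j : ℝ) ^ η)
    (hfm : ∀ j : ℕ, 2 ≤ j → AntitoneOn (f j) (Set.Icc (1 / (2 * (j:ℝ))) (1 / (j:ℝ))))
    (hfb : ∀ j : ℕ, 2 ≤ j → ∀ t ∈ Set.Icc (1 / (j:ℝ)) 1, f j t = 1)
    (hfone : ∀ j : ℕ, 2 ≤ j → ∀ t ∈ Set.Icc (0:ℝ) 1, 1 ≤ f j t) :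
    (∀ j : ℕ, 2 ≤ j → ∀ p q : ℝ × Disk n,
      p.1 ∈ Set.Icc (0:ℝ) 1 → q.1 ∈ Set.Icc (0:ℝ) 1 →
      nullDist (tWarp fun _ => (1:ℝ)) (fun p => p.1) 0 1 p q ≤
        nullDist (tWarp (f j)) (fun p => p.1) 0 1 p q ∧
      nullDist (tWarp (f j)) (fun p => p.1) 0 1 p q ≤
        nullDist (tWarp fun _ => (1:ℝ)) (fun p => p.1) 0 1 p q + 2 / (j:ℝ)) ∧
    -- in particular, uniform convergence `d̂_{t,gⱼ} → d̂_{t,g₀}`: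
    (∀ ε > 0, ∃ N : ℕ, ∀ j ≥ N, 2 ≤ j → ∀ p q : ℝ × Disk n,
      p.1 ∈ Set.Icc (0:ℝ) 1 → q.1 ∈ Set.Icc (0:ℝ) 1 →
      |nullDist (tWarp (f j)) (fun p => p.1) 0 1 p q -
        nullDist (tWarp fun _ => (1:ℝ)) (fun p => p.1) 0 1 p q| ≤ ε) := by
  have main : ∀ j : ℕ, 2 ≤ j → ∀ p q : ℝ × Disk n,
      p.1 ∈ Set.Icc (0:ℝ) 1 → q.1 ∈ Set.Icc (0:ℝ) 1 →
      nullDist (tWarp fun _ => (1:ℝ)) (fun p => p.1) 0 1 p q ≤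
        nullDist (tWarp (f j)) (fun p => p.1) 0 1 p q ∧
      nullDist (tWarp (f j)) (fun p => p.1) 0 1 p q ≤
        nullDist (tWarp fun _ => (1:ℝ)) (fun p => p.1) 0 1 p q + 2 / (j:ℝ) := by
    intro j hj p q hp hq
    have hj' : (2:ℝ) ≤ j := by exact_mod_cast hj
    have := main_bound (a := 1 / (j:ℝ)) (by positivity)
      ((div_lt_one (by linarith)).2 (by linarith)) (hfc j hj) (hfb j hj) (hfone j hj) p q hp hq
    rwa [mul_one_div] at this
  refine ⟨main, fun ε hε => ?_⟩
  obtain ⟨N, hN⟩ := exists_nat_gt (2 / ε)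
  refine ⟨N, fun j hj hj2 p q hp hq => ?_⟩
  obtain ⟨h1, h2⟩ := main j hj2 p q hp hq
  have hjN : (N:ℝ) ≤ j := by exact_mod_cast hj
  have hj' : (2:ℝ) ≤ j := by exact_mod_cast hj2
  have h3 : 2 / (j:ℝ) ≤ ε := by
    rw [div_lt_iff₀ hε] at hN
    rw [div_le_iff₀ (by linarith)]
    nlinarith
  rw [abs_of_nonneg (by linarith)]
  linarith
end
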